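/- arXiv:2407.18688 — 2 statements merged into one kernel-verified Lean document; each statement's English description precedes it below -/
import Mathlib

section
/- Let 2 ≤ k ≤ n−2 be integers, set p₁ = 1/(n−k+1), and let ρ be the supremum of all p₂ ≥ p₁ such that M(n,k,p) = (1/C(n−k+1,2)) · p^{k−2} · B(n−k+2, 2, p) holds for all p ∈ [p₁, p₂]. Then: ρ = 2/(n−1) if k = 2; ρ = 2/(n−2) if k = 3; and if k ≥ 4, then the cubic polynomial f(p) = 1 − C(n−k+3,1)·p + (5/6)·C(n−k+3,2)·p² − (1/2)·C(n−k+3,3)·p³ has a unique zero in the interval [1/(n−k+1), 2/(n−k+1)], and ρ equals this zero. -/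
open scoped BigOperators

noncomputable section

/-- The probability, under the mass function `f` on `{0,1}^n`, of the event that
all coordinates in `S` equal `1` (i.e. `true`). -/
def prAll {n : ℕ} (f : (Fin n → Bool) → ℝ) (S : Finset (Fin n)) : ℝ :=
  ∑ x ∈ Finset.univ.filter (fun x : Fin n → Bool => ∀ i ∈ S, x i = true), f x

/-- `f` is the mass function of a probability measure on `{0,1}^n` making the
coordinate random variables `k`-wise independent Bernoulli(`p`) bits:
`P(X_{i₁} = ⋯ = X_{i_s} = 1) = p ^ s` for all `1 ≤ s ≤ k`. -/
def memA (n k : ℕ) (p : ℝ) (f : (Fin n → Bool) → ℝ) : Prop :=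
  (∀ x, 0 ≤ f x) ∧ (∑ x, f x) = 1 ∧
    ∀ S : Finset (Fin n), 1 ≤ S.card → S.card ≤ k → prAll f S = p ^ S.card

/-- `M n k p`: the maximum of `P(X₁ = ⋯ = Xₙ = 1)` over `A(n,k,p)`. -/
def M (n k : ℕ) (p : ℝ) : ℝ :=
  sSup {y : ℝ | ∃ f, memA n k p f ∧ prAll f Finset.univ = y}

/-- Bonferroni polynomial `B(m,l,x) = Σ_{i=0}^{l} (−1)^i C(m,i) x^i`;
by convention it is `0` for negative `l`. -/
def bonf (m : ℕ) (l : ℤ) (x : ℝ) : ℝ :=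
  if l < 0 then 0
  else ∑ i ∈ Finset.range (l.toNat + 1), (-1 : ℝ) ^ i * (m.choose i) * x ^ i

/-- The cubic polynomial `1 - C(n-k+3,1) x + (5/6) C(n-k+3,2) x² - (1/2) C(n-k+3,3) x³`. -/
def cubic (n k : ℕ) (x : ℝ) : ℝ :=
  1 - ((n - k + 3).choose 1 : ℝ) * x + 5 / 6 * ((n - k + 3).choose 2 : ℝ) * x ^ 2
    - 1 / 2 * ((n - k + 3).choose 3 : ℝ) * x ^ 3

/-- The expectation of `h` under the binomial distribution with parameters `n` and `p`. -/
def binE (n : ℕ) (p : ℝ) (h : ℕ → ℝ) : ℝ :=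
  ∑ j ∈ Finset.range (n + 1), (n.choose j : ℝ) * p ^ j * (1 - p) ^ (n - j) * h j

lemma binE_add (n : ℕ) (p : ℝ) (g h : ℕ → ℝ) :
    binE n p (fun j => g j + h j) = binE n p g + binE n p h := by
  simp only [binE, mul_add, Finset.sum_add_distrib]

lemma binE_const_mul (n : ℕ) (p c : ℝ) (h : ℕ → ℝ) :
    binE n p (fun j => c * h j) = c * binE n p h := by
  simp only [binE, Finset.mul_sum]
  exact Finset.sum_congr rfl fun j _ => by ring

lemma binE_sum {ι : Type*} (s : Finset ι) (n : ℕ) (p : ℝ) (h : ι → ℕ → ℝ) :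
    binE n p (fun j => ∑ i ∈ s, h i j) = ∑ i ∈ s, binE n p (h i) := by
  simp only [binE, Finset.mul_sum]
  exact Finset.sum_comm

lemma binE_one (n : ℕ) (p : ℝ) : binE n p (fun _ => 1) = 1 := by
  have h := add_pow p (1 - p) n
  simp only [add_sub_cancel, one_pow] at h
  refine Eq.trans ?_ h.symm
  exact Finset.sum_congr rfl fun j _ => by ring

lemma binE_id_mul (n : ℕ) (p : ℝ) (g : ℕ → ℝ) :
    binE (n + 1) p (fun j => (j : ℝ) * g j) =
      ((n : ℝ) + 1) * p * binE n p (fun j => g (j + 1)) := by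
  rw [binE, Finset.sum_range_succ', binE, Finset.mul_sum]
  simp only [Nat.cast_zero, zero_mul, mul_zero, add_zero]
  refine Finset.sum_congr rfl fun j _ => ?_
  have h : ((n : ℝ) + 1) * (n.choose j : ℝ) = ((n + 1).choose (j + 1) : ℝ) * ((j : ℝ) + 1) := by
    exact_mod_cast Nat.add_one_mul_choose_eq n j
  rw [Nat.add_sub_add_right]
  push_cast
  linear_combination (-(p ^ (j + 1) * (1 - p) ^ (n - j) * g (j + 1))) * h

lemma binE_sub_mul (n : ℕ) (p : ℝ) (g : ℕ → ℝ) :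
    binE (n + 1) p (fun j => ((n : ℝ) + 1 - j) * g j) =
      ((n : ℝ) + 1) * (1 - p) * binE n p g := by
  rw [binE, Finset.sum_range_succ, binE, Finset.mul_sum]
  simp only [Nat.cast_add, Nat.cast_one, sub_self, zero_mul, mul_zero, add_zero]
  refine Finset.sum_congr rfl fun j hj => ?_
  have hj' : j ≤ n := by simpa [Nat.lt_succ_iff] using hj
  have h : (n.choose j : ℝ) * ((n : ℝ) + 1) = ((n + 1).choose j : ℝ) * ((n : ℝ) + 1 - j) := by
    have := Nat.choose_mul_succ_eq n j
    have h2 : ((n + 1 - j : ℕ) : ℝ) = (n : ℝ) + 1 - j := by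
      rw [Nat.cast_sub (by omega)]; push_cast; ring
    rw [← h2]; exact_mod_cast this
  rw [Nat.sub_add_comm hj', pow_succ]
  linear_combination (-(p ^ j * (1 - p) ^ (n - j) * (1 - p) * g j)) * h

lemma binE_descFactorial_mul (n s : ℕ) (p : ℝ) (g : ℕ → ℝ) :
    binE (n + s) p (fun j => (j.descFactorial s : ℝ) * g j) =
      ((n + s).descFactorial s : ℝ) * p ^ s * binE n p (fun j => g (j + s)) := by
  induction s generalizing g with
  | zero => simp
  | succ s ih =>
    have h1 : (fun j : ℕ => (j.descFactorial (s + 1) : ℝ) * g j) =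
        fun j : ℕ => (j : ℝ) * (((j - 1).descFactorial s : ℝ) * g j) := by
      funext j
      cases j with
      | zero => simp
      | succ j => rw [Nat.succ_descFactorial_succ, Nat.add_sub_cancel]; push_cast; ring
    rw [h1, ← Nat.add_assoc, binE_id_mul]
    simp only [Nat.add_sub_cancel]
    rw [ih (fun j => g (j + 1)), Nat.succ_descFactorial_succ]
    push_cast
    simp only [Nat.add_assoc, Nat.add_comm s 1]
    ring

lemma binE_descFactorial (n s : ℕ) (p : ℝ) :
    binE n p (fun j => (j.descFactorial s : ℝ)) = (n.descFactorial s : ℝ) * p ^ s := by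
  rcases le_or_gt s n with h | h
  · obtain ⟨d, rfl⟩ := Nat.exists_eq_add_of_le' h
    simpa [binE_one] using binE_descFactorial_mul d s p (fun _ => 1)
  · rw [Nat.descFactorial_of_lt h, binE]
    simp only [Nat.cast_zero, zero_mul]
    refine Finset.sum_eq_zero fun j hj => ?_
    rw [Nat.descFactorial_of_lt (by simp at hj; omega)]
    simp

/-- Bit strings correspond to the sets of positions carrying a `1`. -/
def bitsEquiv (n : ℕ) : (Fin n → Bool) ≃ Finset (Fin n) where
  toFun x := Finset.univ.filter fun i => x i = true
  invFun B := fun i => decide (i ∈ B)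
  left_inv x := by funext i; simp
  right_inv B := by ext i; simp

lemma sum_eq_sum_bitsEquiv {n : ℕ} (f : (Fin n → Bool) → ℝ) :
    ∑ x, f x = ∑ B, f ((bitsEquiv n).symm B) :=
  ((bitsEquiv n).symm.sum_comp f).symm

lemma prAll_eq {n : ℕ} (f : (Fin n → Bool) → ℝ) (A : Finset (Fin n)) :
    prAll f A = ∑ B, if A ⊆ B then f ((bitsEquiv n).symm B) else 0 := by
  rw [prAll, Finset.sum_filter, sum_eq_sum_bitsEquiv]
  refine Finset.sum_congr rfl fun B _ => ?_
  simp [bitsEquiv, Finset.subset_iff]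

lemma prAll_univ {n : ℕ} (f : (Fin n → Bool) → ℝ) :
    prAll f Finset.univ = f ((bitsEquiv n).symm Finset.univ) := by
  rw [prAll_eq]
  simp [Finset.univ_subset_iff]

lemma sum_choose_eq_sum_prAll {n : ℕ} (f : (Fin n → Bool) → ℝ) (s : ℕ) :
    ∑ B, f ((bitsEquiv n).symm B) * (B.card.choose s : ℝ) =
      ∑ A ∈ Finset.powersetCard s Finset.univ, prAll f A := by
  simp only [prAll_eq]
  rw [Finset.sum_comm]
  refine Finset.sum_congr rfl fun B _ => ?_
  rw [← Finset.sum_filter, Finset.sum_const, nsmul_eq_mul, mul_comm, ← Finset.card_powersetCard]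
  congr 3
  ext A
  simp [Finset.mem_powersetCard, and_comm]

lemma memA.sum_descFactorial {n k : ℕ} {p : ℝ} {f : (Fin n → Bool) → ℝ} (hf : memA n k p f)
    {s : ℕ} (hs : s ≤ k) :
    ∑ B, f ((bitsEquiv n).symm B) * (B.card.descFactorial s : ℝ) =
      (n.descFactorial s : ℝ) * p ^ s := by
  have h1 : ∑ B, f ((bitsEquiv n).symm B) * (B.card.choose s : ℝ) = (n.choose s : ℝ) * p ^ s := by
    rcases Nat.eq_zero_or_pos s with rfl | h0
    · have := hf.2.1
      rw [sum_eq_sum_bitsEquiv] at this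
      simpa using this
    · rw [sum_choose_eq_sum_prAll, Finset.sum_congr rfl (g := fun _ => p ^ s)]
      · simp
      · intro A hA
        have hA := (Finset.mem_powersetCard.1 hA).2
        rw [hf.2.2 A (by omega) (by omega), hA]
  simp only [Nat.descFactorial_eq_factorial_mul_choose, Nat.cast_mul]
  rw [mul_assoc, ← h1, Finset.mul_sum]
  exact Finset.sum_congr rfl fun B _ => by ring

open Polynomial in
/-- Polynomials of degree at most `k` are spanned by falling factorials. -/
lemma exists_eval_eq_sum_descFactorial (k : ℕ) (P : ℝ[X]) (hP : P.natDegree ≤ k) :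
    ∃ c : ℕ → ℝ, ∀ j : ℕ, P.eval (j : ℝ) =
      ∑ s ∈ Finset.range (k + 1), c s * (j.descFactorial s : ℝ) := by
  induction k generalizing P with
  | zero =>
    refine ⟨fun _ => P.coeff 0, fun j => ?_⟩
    rw [Polynomial.eq_C_of_natDegree_le_zero hP]
    simp
  | succ k ih =>
    set Q := P - C (P.coeff (k + 1)) * descPochhammer ℝ (k + 1) with hQ
    have hmon : (descPochhammer ℝ (k + 1)).coeff (k + 1) = 1 := by
      have h := monic_descPochhammer ℝ (k + 1)
      have h2 := descPochhammer_natDegree ℝ (k + 1)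
      rw [Monic, leadingCoeff, h2] at h
      exact h
    have hdeg : Q.natDegree ≤ k := by
      rw [Polynomial.natDegree_le_iff_coeff_eq_zero]
      intro N hN
      rcases Nat.lt_or_ge (k + 1) N with h | h
      · rw [hQ, coeff_sub, coeff_C_mul, coeff_eq_zero_of_natDegree_lt (p := P) (by omega),
          coeff_eq_zero_of_natDegree_lt (p := descPochhammer ℝ (k + 1))
            (by rw [descPochhammer_natDegree]; omega)]
        simp
      · obtain rfl : N = k + 1 := by omega
        rw [hQ, coeff_sub, coeff_C_mul, hmon]; ring
    obtain ⟨c, hc⟩ := ih Q hdeg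
    refine ⟨Function.update c (k + 1) (P.coeff (k + 1)), fun j => ?_⟩
    have h := hc j
    rw [hQ, eval_sub, eval_mul, eval_C, descPochhammer_eval_eq_descFactorial] at h
    rw [Finset.sum_range_succ, Function.update_self, ← sub_eq_iff_eq_add, h]
    refine Finset.sum_congr rfl fun s hs => ?_
    rw [Function.update_of_ne (by simp at hs; omega)]

open Polynomial in
lemma memA.sum_eval {n k : ℕ} {p : ℝ} {f : (Fin n → Bool) → ℝ} (hf : memA n k p f)
    (P : ℝ[X]) (hP : P.natDegree ≤ k) :
    ∑ B, f ((bitsEquiv n).symm B) * P.eval (B.card : ℝ) =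
      binE n p (fun j => P.eval (j : ℝ)) := by
  obtain ⟨c, hc⟩ := exists_eval_eq_sum_descFactorial k P hP
  simp only [hc, binE_sum, Finset.mul_sum]
  rw [Finset.sum_comm]
  refine Finset.sum_congr rfl fun s hs => ?_
  rw [binE_const_mul, binE_descFactorial,
    ← hf.sum_descFactorial (show s ≤ k by simp at hs; omega), Finset.mul_sum]
  exact Finset.sum_congr rfl fun B _ => by ring

/-- The number of sets of size `j` containing a given set `A`. -/
lemma card_filter_superset {n : ℕ} (A : Finset (Fin n)) (j : ℕ) (hj : A.card ≤ j) :
    (Finset.univ.filter fun B : Finset (Fin n) => A ⊆ B ∧ B.card = j).card =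
      (n - A.card).choose (j - A.card) := by
  have h : (Finset.powersetCard (j - A.card) Aᶜ).card = (n - A.card).choose (j - A.card) := by
    rw [Finset.card_powersetCard, Finset.card_compl, Fintype.card_fin]
  rw [← h]
  refine Finset.card_nbij' (fun B => B \ A) (fun C => C ∪ A) ?_ ?_ ?_ ?_
  · intro B hB
    simp only [Finset.coe_filter, Finset.mem_univ, true_and, Set.mem_ofPred_eq] at hB
    simp only [Finset.mem_coe, Finset.mem_powersetCard]
    refine ⟨fun x hx => by simp at hx ⊢; exact hx.2, ?_⟩
    rw [Finset.card_sdiff_of_subset hB.1, hB.2]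
  · intro C hC
    simp only [Finset.mem_coe, Finset.mem_powersetCard] at hC
    simp only [Finset.coe_filter, Finset.mem_univ, true_and, Set.mem_ofPred_eq]
    refine ⟨Finset.subset_union_right, ?_⟩
    rw [Finset.card_union_of_disjoint, hC.2]
    · omega
    · rw [Finset.disjoint_left]
      intro x hx
      simpa using hC.1 hx
  · intro B hB
    simp only [Finset.coe_filter, Finset.mem_univ, true_and, Set.mem_ofPred_eq] at hB
    exact Finset.sdiff_union_of_subset hB.1
  · intro C hC
    simp only [Finset.mem_coe, Finset.mem_powersetCard] at hC
    apply Finset.union_sdiff_cancel_right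
    rw [Finset.disjoint_left]
    intro x hx
    simpa using hC.1 hx

/-- The exchangeable mass function under which the number of ones has distribution `w`. -/
def exchangeable (n : ℕ) (w : ℕ → ℝ) (x : Fin n → Bool) : ℝ :=
  w (bitsEquiv n x).card / (n.choose (bitsEquiv n x).card : ℝ)

lemma prAll_exchangeable (n : ℕ) (w : ℕ → ℝ) (A : Finset (Fin n)) :
    prAll (exchangeable n w) A * (n.descFactorial A.card : ℝ) =
      ∑ j ∈ Finset.range (n + 1), w j * (j.descFactorial A.card : ℝ) := by
  have hAn : A.card ≤ n := by simpa using Finset.card_le_univ A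
  have h1 : prAll (exchangeable n w) A = ∑ j ∈ Finset.range (n + 1),
      ((Finset.univ.filter fun B : Finset (Fin n) => A ⊆ B ∧ B.card = j).card : ℝ) *
        (w j / (n.choose j : ℝ)) := by
    rw [prAll_eq, ← Finset.sum_fiberwise_of_maps_to (s := Finset.univ)
      (t := Finset.range (n + 1)) (g := fun B : Finset (Fin n) => B.card)]
    · refine Finset.sum_congr rfl fun j _ => ?_
      rw [← nsmul_eq_mul, ← Finset.sum_const, ← Finset.sum_filter, Finset.filter_filter]
      refine Finset.sum_congr (by ext B; simp [and_comm]) fun B hB => ?_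
      simp only [Finset.mem_filter, Finset.mem_univ, true_and] at hB
      simp [exchangeable, hB.2]
    · intro B _
      have : B.card ≤ n := by simpa using Finset.card_le_univ B
      simp; omega
  rw [h1, Finset.sum_mul]
  refine Finset.sum_congr rfl fun j hj => ?_
  have hjn : j ≤ n := by simp at hj; omega
  rcases Nat.lt_or_ge j A.card with h | h
  · rw [Nat.descFactorial_of_lt h, Finset.card_eq_zero.2]
    · simp
    · ext B
      simp only [Finset.mem_filter, Finset.mem_univ, true_and, Finset.notMem_empty, iff_false]
      rintro ⟨hB, rfl⟩
      exact absurd (Finset.card_le_card hB) (by omega)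
  · rw [card_filter_superset A j h]
    have hc : (n.choose j : ℝ) ≠ 0 := by exact_mod_cast (Nat.choose_pos hjn).ne'
    have h2 : (n.choose j : ℝ) * (j.choose A.card : ℝ) =
        (n.choose A.card : ℝ) * ((n - A.card).choose (j - A.card) : ℝ) := by
      exact_mod_cast Nat.choose_mul h
    simp only [Nat.descFactorial_eq_factorial_mul_choose, Nat.cast_mul]
    field_simp
    linear_combination (-w j) * h2

lemma memA_exchangeable {n k : ℕ} (hk : k ≤ n) {p : ℝ} {w : ℕ → ℝ} (hw : ∀ j, 0 ≤ w j)
    (h : ∀ s ≤ k, ∑ j ∈ Finset.range (n + 1), w j * (j.descFactorial s : ℝ) =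
      (n.descFactorial s : ℝ) * p ^ s) :
    memA n k p (exchangeable n w) := by
  have key : ∀ A : Finset (Fin n), A.card ≤ k → prAll (exchangeable n w) A = p ^ A.card := by
    intro A hA
    have h1 := prAll_exchangeable n w A
    rw [h _ hA, mul_comm] at h1
    refine mul_left_cancel₀ ?_ h1
    exact_mod_cast (Nat.descFactorial_pos.2 (hA.trans hk)).ne'
  refine ⟨fun x => div_nonneg (hw _) (Nat.cast_nonneg _), ?_, fun S _ hS => key S hS⟩
  have h0 := key ∅ (by simp)
  simpa [prAll] using h0

open Polynomial in
/-- The Lagrange basis polynomial of the node `i` for the integer nodes `V`. -/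
abbrev nodeBasis (V : Finset ℕ) (i : ℕ) : ℝ[X] :=
  Lagrange.basis V (fun v : ℕ => (v : ℝ)) i

/-- The mass at the node `i` of the signed measure on `V` that matches the moments of the
binomial distribution. -/
def nodeWeight (V : Finset ℕ) (n : ℕ) (p : ℝ) (i : ℕ) : ℝ :=
  binE n p fun j => (nodeBasis V i).eval (j : ℝ)

lemma injOn_natCast (V : Finset ℕ) : Set.InjOn (fun v : ℕ => (v : ℝ)) V :=
  fun _ _ _ _ h => Nat.cast_injective h

lemma eval_nodeBasis (V : Finset ℕ) (i : ℕ) (x : ℝ) :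
    (nodeBasis V i).eval x =
      (∏ v ∈ V.erase i, ((i : ℝ) - v))⁻¹ * ∏ v ∈ V.erase i, (x - v) := by
  simp [nodeBasis, Lagrange.basis, Lagrange.basisDivisor, Polynomial.eval_prod,
    Finset.prod_mul_distrib]

lemma nodeWeight_eq (V : Finset ℕ) (n : ℕ) (p : ℝ) (i : ℕ) :
    nodeWeight V n p i = (∏ v ∈ V.erase i, ((i : ℝ) - v))⁻¹ *
      binE n p fun j => ∏ v ∈ V.erase i, ((j : ℝ) - v) := by
  rw [nodeWeight, ← binE_const_mul]
  simp only [eval_nodeBasis]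

open Polynomial in
lemma sum_nodeWeight_mul_eval {V : Finset ℕ} {k : ℕ} (hV : V.card = k + 1) (n : ℕ) (p : ℝ)
    (P : ℝ[X]) (hP : P.natDegree ≤ k) :
    ∑ v ∈ V, nodeWeight V n p v * P.eval (v : ℝ) = binE n p fun j => P.eval (j : ℝ) := by
  have hdeg : P.degree < V.card := by
    rw [hV]
    exact lt_of_le_of_lt Polynomial.degree_le_natDegree (by exact_mod_cast Nat.lt_succ_of_le hP)
  have h := Lagrange.eq_interpolate (injOn_natCast V) hdeg
  have h2 : ∀ x : ℝ, P.eval x = ∑ v ∈ V, P.eval (v : ℝ) * (nodeBasis V v).eval x := by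
    intro x
    conv_lhs => rw [h]
    simp [Lagrange.interpolate_apply, eval_finsetSum]
  rw [show (fun j : ℕ => P.eval (j : ℝ)) =
    fun j : ℕ => ∑ v ∈ V, P.eval (v : ℝ) * (nodeBasis V v).eval (j : ℝ) from
      funext fun j => h2 j, binE_sum]
  refine Finset.sum_congr rfl fun v _ => ?_
  rw [binE_const_mul, nodeWeight, mul_comm]

/-- Nonnegative node weights give an element of `A(n,k,p)`. -/
lemma exists_memA_of_nodeWeight_nonneg {V : Finset ℕ} {n k : ℕ} (hV : V.card = k + 1)
    (hVn : ∀ v ∈ V, v ≤ n) (hnV : n ∈ V) (hk : k ≤ n) {p : ℝ}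
    (hw : ∀ v ∈ V, 0 ≤ nodeWeight V n p v) :
    ∃ f, memA n k p f ∧ prAll f Finset.univ = nodeWeight V n p n := by
  set w : ℕ → ℝ := fun j => if j ∈ V then nodeWeight V n p j else 0 with hwdef
  refine ⟨exchangeable n w, memA_exchangeable hk ?_ ?_, ?_⟩
  · intro j
    simp only [hwdef]
    split_ifs with h
    · exact hw j h
    · exact le_rfl
  · intro s hs
    have hsub : V ⊆ Finset.range (n + 1) := fun v hv => by
      have := hVn v hv
      simp; omega
    rw [← binE_descFactorial, ← Finset.sum_subset hsub]
    · have h := sum_nodeWeight_mul_eval hV n p (descPochhammer ℝ s)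
        (by rw [descPochhammer_natDegree]; exact hs)
      simp only [descPochhammer_eval_eq_descFactorial] at h
      rw [← h]
      refine Finset.sum_congr rfl fun v hv => ?_
      simp [hwdef, hv]
    · intro v _ hv
      simp [hwdef, hv]
  · rw [prAll_univ]
    simp [exchangeable, hwdef, hnV]

/-- Weak duality. -/
lemma memA.prAll_univ_le {n k : ℕ} {p : ℝ} {f : (Fin n → Bool) → ℝ} (hf : memA n k p f)
    (P : Polynomial ℝ) (hP : P.natDegree ≤ k) (h0 : ∀ j < n, 0 ≤ P.eval (j : ℝ))
    (h1 : 1 ≤ P.eval (n : ℝ)) :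
    prAll f Finset.univ ≤ binE n p fun j => P.eval (j : ℝ) := by
  rw [← hf.sum_eval P hP, prAll_univ]
  have hnn : ∀ j ≤ n, 0 ≤ P.eval (j : ℝ) := fun j hj => by
    rcases hj.lt_or_eq with h | rfl
    · exact h0 j h
    · linarith
  refine le_trans ?_ (Finset.single_le_sum
    (f := fun B => f ((bitsEquiv n).symm B) * P.eval (B.card : ℝ)) (fun B _ => ?_)
    (Finset.mem_univ Finset.univ))
  · simpa using le_mul_of_one_le_right (hf.1 _) h1
  · exact mul_nonneg (hf.1 _) (hnn _ (by simpa using Finset.card_le_univ B))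

lemma natDegree_nodeBasis_le {V : Finset ℕ} {k : ℕ} (hV : V.card = k + 1) {i : ℕ} (hi : i ∈ V) :
    (nodeBasis V i).natDegree ≤ k := by
  rw [nodeBasis, Lagrange.natDegree_basis (injOn_natCast V) hi, hV, Nat.add_sub_cancel]

lemma eval_nodeBasis_self {V : Finset ℕ} {i : ℕ} (hi : i ∈ V) :
    (nodeBasis V i).eval (i : ℝ) = 1 :=
  Lagrange.eval_basis_self (injOn_natCast V) hi

lemma eval_nodeBasis_of_ne {V : Finset ℕ} {i j : ℕ} (hij : i ≠ j) (hj : j ∈ V) :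
    (nodeBasis V i).eval (j : ℝ) = 0 :=
  Lagrange.eval_basis_of_ne (v := fun v : ℕ => (v : ℝ)) hij hj

lemma memA.prAll_univ_le_nodeWeight {V : Finset ℕ} {n k : ℕ} (hV : V.card = k + 1) (hnV : n ∈ V)
    (hpos : ∀ j < n, j ∉ V → 0 < (nodeBasis V n).eval (j : ℝ))
    {p : ℝ} {f : (Fin n → Bool) → ℝ} (hf : memA n k p f) :
    prAll f Finset.univ ≤ nodeWeight V n p n := by
  refine hf.prAll_univ_le _ (natDegree_nodeBasis_le hV hnV) (fun j hj => ?_)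
    (eval_nodeBasis_self hnV).ge
  by_cases h : j ∈ V
  · rw [eval_nodeBasis_of_ne hj.ne' h]
  · exact (hpos j hj h).le

lemma M_eq_nodeWeight {V : Finset ℕ} {n k : ℕ} (hV : V.card = k + 1)
    (hVn : ∀ v ∈ V, v ≤ n) (hnV : n ∈ V)
    (hpos : ∀ j < n, j ∉ V → 0 < (nodeBasis V n).eval (j : ℝ))
    (hk : k ≤ n) {p : ℝ} (hw : ∀ v ∈ V, 0 ≤ nodeWeight V n p v) :
    M n k p = nodeWeight V n p n := by
  refine IsGreatest.csSup_eq ⟨exists_memA_of_nodeWeight_nonneg hV hVn hnV hk hw, ?_⟩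
  rintro y ⟨f, hf, rfl⟩
  exact hf.prAll_univ_le_nodeWeight hV hnV hpos

lemma M_lt_nodeWeight {V : Finset ℕ} {n k : ℕ} (hV : V.card = k + 1) (hnV : n ∈ V)
    (hpos : ∀ j < n, j ∉ V → 0 < (nodeBasis V n).eval (j : ℝ))
    {p : ℝ} {i : ℕ} (hi : i ∈ V) (hin : i ≠ n)
    (hw : nodeWeight V n p i < 0) (hn : 0 < nodeWeight V n p n) :
    M n k p < nodeWeight V n p n := by
  open Filter Topology in
  have hev : ∀ᶠ δ : ℝ in 𝓝[>] 0, (∀ j ∈ Finset.range n,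
      0 ≤ (nodeBasis V n).eval (j : ℝ) + δ * (nodeBasis V i).eval (j : ℝ)) ∧
      0 < nodeWeight V n p n + δ * nodeWeight V n p i := by
    have hlim : ∀ a b : ℝ, 0 < a → ∀ᶠ δ : ℝ in 𝓝[>] 0, 0 < a + δ * b := by
      intro a b ha
      have hc : Tendsto (fun δ : ℝ => a + δ * b) (𝓝[>] 0) (𝓝 (a + 0 * b)) :=
        (Continuous.tendsto (by fun_prop) 0).mono_left nhdsWithin_le_nhds
      exact hc.eventually (lt_mem_nhds (by simpa using ha))
    refine Filter.Eventually.and ?_ (hlim _ _ hn)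
    rw [Filter.eventually_all_finset]
    intro j hj
    have hj : j < n := by simpa using hj
    by_cases h : j ∈ V
    · rw [eval_nodeBasis_of_ne hj.ne' h]
      by_cases hij : i = j
      · subst hij
        filter_upwards [self_mem_nhdsWithin] with δ hδ
        rw [eval_nodeBasis_self hi]
        simpa using (show (0 : ℝ) < δ from hδ).le
      · simp [eval_nodeBasis_of_ne hij h]
    · exact (hlim _ _ (hpos j hj h)).mono fun _ h => h.le
  obtain ⟨δ, ⟨hδ, hδ'⟩, hδ0⟩ := (hev.and self_mem_nhdsWithin).exists
  have hδ0 : 0 < δ := hδ0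
  have hle : M n k p ≤ nodeWeight V n p n + δ * nodeWeight V n p i := by
    refine Real.sSup_le ?_ hδ'.le
    rintro y ⟨f, hf, rfl⟩
    have h := hf.prAll_univ_le (nodeBasis V n + Polynomial.C δ * nodeBasis V i) ?_ ?_ ?_
    · simpa [nodeWeight, binE_add, binE_const_mul] using h
    · refine (Polynomial.natDegree_add_le _ _).trans (max_le (natDegree_nodeBasis_le hV hnV) ?_)
      exact (Polynomial.natDegree_C_mul_le _ _).trans (natDegree_nodeBasis_le hV hi)
    · intro j hj
      simpa using hδ j (by simpa using hj)
    · simp [eval_nodeBasis_self hnV, eval_nodeBasis_of_ne hin hnV]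
  nlinarith

/-- The support of the extremal distribution of the number of ones, for `k = K + 2` and
`n = K + m`. -/
def nodes (K m : ℕ) : Finset ℕ :=
  insert (K + 1) (insert (K + 2) (insert (K + m) (Finset.range K)))

lemma mem_nodes {K m j : ℕ} :
    j ∈ nodes K m ↔ j = K + 1 ∨ j = K + 2 ∨ j = K + m ∨ j < K := by
  simp [nodes]

lemma card_nodes (K m : ℕ) (hm : 4 ≤ m) : (nodes K m).card = K + 2 + 1 := by
  rw [nodes, Finset.card_insert_of_notMem, Finset.card_insert_of_notMem,
    Finset.card_insert_of_notMem, Finset.card_range] <;> simp <;> omega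

lemma le_of_mem_nodes {K m : ℕ} (hm : 4 ≤ m) : ∀ v ∈ nodes K m, v ≤ K + m := by
  intro v hv
  rw [mem_nodes] at hv
  omega

lemma last_mem_nodes (K m : ℕ) : K + m ∈ nodes K m := by simp [mem_nodes]

lemma prod_range_sub_eq_descFactorial (K j : ℕ) :
    ∏ v ∈ Finset.range K, ((j : ℝ) - v) = (j.descFactorial K : ℝ) := by
  rw [← descPochhammer_eval_eq_prod_range, descPochhammer_eval_eq_descFactorial]

lemma prod_erase_last {K m : ℕ} (hm : 4 ≤ m) (j : ℕ) :
    ∏ v ∈ (nodes K m).erase (K + m), ((j : ℝ) - v) =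
      (j.descFactorial K : ℝ) * (((j : ℝ) - K - 1) * ((j : ℝ) - K - 2)) := by
  have h : (nodes K m).erase (K + m) = insert (K + 1) (insert (K + 2) (Finset.range K)) := by
    ext v
    simp only [Finset.mem_erase, mem_nodes, Finset.mem_insert, Finset.mem_range]
    omega
  rw [h, Finset.prod_insert (by simp), Finset.prod_insert (by simp),
    prod_range_sub_eq_descFactorial]
  push_cast
  ring

lemma prod_erase_one {K m : ℕ} (hm : 4 ≤ m) (j : ℕ) :
    ∏ v ∈ (nodes K m).erase (K + 1), ((j : ℝ) - v) =
      (j.descFactorial K : ℝ) * (((j : ℝ) - K - 2) * ((j : ℝ) - K - m)) := by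
  have h : (nodes K m).erase (K + 1) = insert (K + 2) (insert (K + m) (Finset.range K)) := by
    ext v
    simp only [Finset.mem_erase, mem_nodes, Finset.mem_insert, Finset.mem_range]
    omega
  rw [h, Finset.prod_insert (by simp; omega), Finset.prod_insert (by simp),
    prod_range_sub_eq_descFactorial]
  push_cast
  ring

lemma prod_erase_two {K m : ℕ} (hm : 4 ≤ m) (j : ℕ) :
    ∏ v ∈ (nodes K m).erase (K + 2), ((j : ℝ) - v) =
      (j.descFactorial K : ℝ) * (((j : ℝ) - K - 1) * ((j : ℝ) - K - m)) := by
  have h : (nodes K m).erase (K + 2) = insert (K + 1) (insert (K + m) (Finset.range K)) := by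
    ext v
    simp only [Finset.mem_erase, mem_nodes, Finset.mem_insert, Finset.mem_range]
    omega
  rw [h, Finset.prod_insert (by simp; omega), Finset.prod_insert (by simp),
    prod_range_sub_eq_descFactorial]
  push_cast
  ring

/-- The polynomial vanishing at `1, …, r`, `r + 2` and `r + 3`. -/
def gapPoly (r : ℕ) (x : ℝ) : ℝ :=
  (∏ s ∈ Finset.range r, (x - 1 - s)) * ((x - r - 2) * (x - r - 3))

lemma prod_erase_low {i r m : ℕ} (hm : 4 ≤ m) (j : ℕ) :
    ∏ v ∈ (nodes (i + 1 + r) m).erase i, ((j : ℝ) - v) =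
      (j.descFactorial i : ℝ) * (gapPoly r ((j : ℝ) - i) * ((j : ℝ) - i - 1 - r - m)) := by
  have h : (nodes (i + 1 + r) m).erase i = insert (i + 1 + r + 1) (insert (i + 1 + r + 2)
      (insert (i + 1 + r + m) (Finset.range i ∪ Finset.Ico (i + 1) (i + 1 + r)))) := by
    ext v
    simp only [Finset.mem_erase, mem_nodes, Finset.mem_insert, Finset.mem_range, Finset.mem_union,
      Finset.mem_Ico]
    omega
  rw [h, Finset.prod_insert (by simp; omega), Finset.prod_insert (by simp; omega),
    Finset.prod_insert (by simp; omega), Finset.prod_union, Finset.prod_Ico_eq_prod_range,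
    prod_range_sub_eq_descFactorial, gapPoly, Nat.add_sub_cancel_left,
    Finset.prod_congr rfl (g := fun s : ℕ => (j : ℝ) - i - 1 - s) fun s _ => by push_cast; ring]
  · push_cast
    ring
  · rw [Finset.disjoint_left]
    intro v hv
    simp at hv ⊢
    omega

lemma eval_nodeBasis_last_pos {K m : ℕ} (hm : 4 ≤ m) (j : ℕ) (hj : j < K + m)
    (hjV : j ∉ nodes K m) : 0 < (nodeBasis (nodes K m) (K + m)).eval (j : ℝ) := by
  rw [eval_nodeBasis, prod_erase_last hm, prod_erase_last hm]
  have key : ∀ l : ℕ, l = K ∨ K + 3 ≤ l →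
      0 < (l.descFactorial K : ℝ) * (((l : ℝ) - K - 1) * ((l : ℝ) - K - 2)) := by
    intro l hl
    have h1 : 0 < (l.descFactorial K : ℝ) := by
      exact_mod_cast Nat.descFactorial_pos.2 (by omega)
    rcases hl with rfl | hl
    · rw [sub_self]; nlinarith
    · have h2 : (K : ℝ) + 3 ≤ l := by exact_mod_cast hl
      exact mul_pos h1 (mul_pos (by linarith) (by linarith))
  rw [mem_nodes] at hjV
  exact mul_pos (inv_pos.2 (key _ (by omega))) (key j (by omega))

lemma binE_linear_mul (N : ℕ) (p : ℝ) :
    binE N p (fun j => ((j : ℝ) - 1) * ((j : ℝ) - 2)) =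
      2 - 2 * (N * p) + N * (N - 1) * p ^ 2 := by
  have h1 := binE_descFactorial N 1 p
  have h2 := binE_descFactorial N 2 p
  have e : (fun j : ℕ => ((j : ℝ) - 1) * ((j : ℝ) - 2)) = fun j : ℕ =>
      (j.descFactorial 2 : ℝ) + (-2 * (j.descFactorial 1 : ℝ) + 2 * 1) := by
    funext j
    simp only [← prod_range_sub_eq_descFactorial, Finset.prod_range_succ, Finset.prod_range_zero]
    push_cast
    ring
  rw [e, binE_add, binE_add, binE_const_mul, binE_const_mul, binE_one, h1, h2]
  simp only [← prod_range_sub_eq_descFactorial, Finset.prod_range_succ, Finset.prod_range_zero]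
  push_cast
  ring

lemma binE_sub_const (N : ℕ) (p c : ℝ) :
    binE N p (fun j => (j : ℝ) - c) = N * p - c := by
  have h1 := binE_descFactorial N 1 p
  have h2 := binE_add N p (fun j => (j : ℝ)) (fun _ => -c * 1)
  rw [binE_const_mul, binE_one] at h2
  simp only [Nat.descFactorial_one, pow_one] at h1
  rw [h1] at h2
  simpa [sub_eq_add_neg] using h2

lemma nodeWeight_last {K m : ℕ} (hm : 4 ≤ m) (p : ℝ) :
    nodeWeight (nodes K m) (K + m) p (K + m) =
      p ^ K * (2 - 2 * (m * p) + m * (m - 1) * p ^ 2) / (((m : ℝ) - 1) * (m - 2)) := by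
  rw [nodeWeight_eq, prod_erase_last hm]
  simp only [prod_erase_last hm]
  rw [Nat.add_comm K m, binE_descFactorial_mul]
  have e : (fun j : ℕ => (((j + K : ℕ) : ℝ) - K - 1) * (((j + K : ℕ) : ℝ) - K - 2)) =
      fun j : ℕ => ((j : ℝ) - 1) * ((j : ℝ) - 2) := by
    funext j; push_cast; ring
  rw [e, binE_linear_mul]
  have h1 : ((m + K).descFactorial K : ℝ) ≠ 0 := by
    exact_mod_cast (Nat.descFactorial_pos.2 (by omega)).ne'
  have h2 : (4 : ℝ) ≤ m := by exact_mod_cast hm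
  have h3 : (m : ℝ) - 1 ≠ 0 := by linarith
  have h4 : (m : ℝ) - 2 ≠ 0 := by linarith
  push_cast
  rw [show (m : ℝ) + K - K - 1 = m - 1 by ring, show (m : ℝ) + K - K - 2 = m - 2 by ring]
  field_simp

/-- The weights at `K + 1` and `K + 2`, up to a positive factor. -/
lemma nodeWeight_one {K m : ℕ} (hm : 4 ≤ m) (p : ℝ) :
    ∃ c : ℝ, 0 < c ∧ nodeWeight (nodes K m) (K + m) p (K + 1) =
      c * (p ^ K * ((1 - p) * (2 - ((m : ℝ) - 1) * p))) := by
  obtain ⟨m, rfl⟩ : ∃ d, m = d + 1 := ⟨m - 1, by omega⟩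
  have h2 : (3 : ℝ) ≤ m := by exact_mod_cast (show 3 ≤ m by omega)
  have h1 : (0 : ℝ) < ((m + 1 + K).descFactorial K : ℝ) := by
    exact_mod_cast Nat.descFactorial_pos.2 (by omega)
  have h3 : (0 : ℝ) < ((K + 1).descFactorial K : ℝ) := by
    exact_mod_cast Nat.descFactorial_pos.2 (by omega)
  refine ⟨((m + 1 + K).descFactorial K : ℝ) * (m + 1) / (((K + 1).descFactorial K : ℝ) * m),
    by positivity, ?_⟩
  rw [nodeWeight_eq, prod_erase_one hm]
  simp only [prod_erase_one hm]
  rw [Nat.add_comm K (m + 1), binE_descFactorial_mul]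
  have e : (fun j : ℕ => (((j + K : ℕ) : ℝ) - K - 2) * (((j + K : ℕ) : ℝ) - K - (m + 1 : ℕ))) =
      fun j : ℕ => -1 * (((m : ℝ) + 1 - j) * ((j : ℝ) - 2)) := by
    funext j; push_cast; ring
  rw [e, binE_const_mul, binE_sub_mul, binE_sub_const]
  push_cast
  have h4 : (m : ℝ) ≠ 0 := by linarith
  rw [show (K : ℝ) + 1 - K - 2 = -1 by ring, show (K : ℝ) + 1 - K - (m + 1) = -m by ring]
  field_simp
  ring

lemma nodeWeight_two {K m : ℕ} (hm : 4 ≤ m) (p : ℝ) :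
    ∃ c : ℝ, 0 < c ∧ nodeWeight (nodes K m) (K + m) p (K + 2) =
      c * (p ^ K * ((1 - p) * (((m : ℝ) - 1) * p - 1))) := by
  obtain ⟨m, rfl⟩ : ∃ d, m = d + 1 := ⟨m - 1, by omega⟩
  have h2 : (3 : ℝ) ≤ m := by exact_mod_cast (show 3 ≤ m by omega)
  have h1 : (0 : ℝ) < ((m + 1 + K).descFactorial K : ℝ) := by
    exact_mod_cast Nat.descFactorial_pos.2 (by omega)
  have h3 : (0 : ℝ) < ((K + 2).descFactorial K : ℝ) := by
    exact_mod_cast Nat.descFactorial_pos.2 (by omega)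
  have h4 : 0 < (m : ℝ) - 1 := by linarith
  refine ⟨((m + 1 + K).descFactorial K : ℝ) * (m + 1) / (((K + 2).descFactorial K : ℝ) * (m - 1)),
    by positivity, ?_⟩
  rw [nodeWeight_eq, prod_erase_two hm]
  simp only [prod_erase_two hm]
  rw [Nat.add_comm K (m + 1), binE_descFactorial_mul]
  have e : (fun j : ℕ => (((j + K : ℕ) : ℝ) - K - 1) * (((j + K : ℕ) : ℝ) - K - (m + 1 : ℕ))) =
      fun j : ℕ => -1 * (((m : ℝ) + 1 - j) * ((j : ℝ) - 1)) := by
    funext j; push_cast; ring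
  rw [e, binE_const_mul, binE_sub_mul, binE_sub_const]
  push_cast
  rw [show (K : ℝ) + 2 - K - 1 = 1 by ring, show (K : ℝ) + 2 - K - (m + 1) = -(m - 1) by ring]
  field_simp
  ring

lemma gapPoly_zero (r : ℕ) :
    gapPoly r 0 = (-1) ^ r * (r.factorial * ((r + 2) * (r + 3))) := by
  have h : ∏ s ∈ Finset.range r, ((0 : ℝ) - 1 - s) = (-1) ^ r * r.factorial := by
    rw [← Finset.prod_range_add_one_eq_factorial]
    push_cast
    rw [← Finset.card_range r, ← Finset.prod_const, Finset.card_range, ← Finset.prod_mul_distrib]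
    exact Finset.prod_congr rfl fun s _ => by ring
  rw [gapPoly, h]
  ring

lemma nodeWeight_low {i r m : ℕ} (hm : 4 ≤ m) (p : ℝ) :
    ∃ c : ℝ, 0 < c ∧ nodeWeight (nodes (i + 1 + r) m) (i + 1 + r + m) p i =
      c * (p ^ i * ((1 - p) * ((-1) ^ r * binE (m + r) p fun j => gapPoly r j))) := by
  have h1 : (0 : ℝ) < ((m + r + 1 + i).descFactorial i : ℝ) := by
    exact_mod_cast Nat.descFactorial_pos.2 (by omega)
  have h2 : (0 : ℝ) < (i.descFactorial i : ℝ) := by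
    exact_mod_cast Nat.descFactorial_pos.2 le_rfl
  refine ⟨((m + r + 1 + i).descFactorial i : ℝ) /
    ((i.descFactorial i : ℝ) * (r.factorial * ((r + 2) * (r + 3)))),
    by positivity, ?_⟩
  rw [nodeWeight_eq, prod_erase_low hm]
  simp only [prod_erase_low hm]
  rw [show i + 1 + r + m = m + r + 1 + i by omega, binE_descFactorial_mul]
  have e : (fun j : ℕ => gapPoly r (((j + i : ℕ) : ℝ) - i) *
        (((j + i : ℕ) : ℝ) - i - 1 - r - m)) =
      fun j : ℕ => -1 * ((((m + r : ℕ) : ℝ) + 1 - j) * gapPoly r j) := by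
    funext j; push_cast; rw [add_sub_cancel_right]; ring
  rw [e, binE_const_mul, binE_sub_mul, sub_self, gapPoly_zero]
  push_cast
  rw [show (0 : ℝ) - 1 - r - m = -(m + r + 1) by ring]
  have h3 : (m : ℝ) + r + 1 ≠ 0 := by positivity
  have h5 : ((-1 : ℝ) ^ r) ≠ 0 := by simp
  have h6 : ((-1 : ℝ) ^ r)⁻¹ = (-1) ^ r := by
    rw [← inv_pow]; norm_num
  simp only [mul_inv, inv_neg, h6]
  field_simp

/-- Up to a positive factor, `1 - gapSum m r (p / (1 - p))` is the weight at the node `i` when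
`K = i + 1 + r` and `r` is odd. -/
def gapSum (m r : ℕ) (q : ℝ) : ℝ :=
  ∑ t ∈ Finset.range m, ((m + r).choose (r + t + 1) : ℝ) * ((r + t).choose r : ℝ) *
    (((t : ℝ) - 1) * (t - 2)) / ((r + 2) * (r + 3)) * q ^ (r + t + 1)

lemma gapPoly_of_lt {r j : ℕ} (h : j < r) : gapPoly r ((j + 1 : ℕ) : ℝ) = 0 := by
  rw [gapPoly, Finset.prod_eq_zero (Finset.mem_range.2 h), zero_mul]
  push_cast; ring

lemma gapPoly_of_ge (r t : ℕ) : gapPoly r ((r + t + 1 : ℕ) : ℝ) =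
    r.factorial * (((r + t).choose r : ℝ) * (((t : ℝ) - 1) * (t - 2))) := by
  have h := prod_range_sub_eq_descFactorial r (r + t)
  rw [Nat.descFactorial_eq_factorial_mul_choose] at h
  rw [gapPoly, Finset.prod_congr rfl (g := fun s : ℕ => ((r + t : ℕ) : ℝ) - s)
    fun s _ => by push_cast; ring, h]
  push_cast
  ring

lemma mul_sub_nonneg_of_nat (t : ℕ) : 0 ≤ ((t : ℝ) - 1) * (t - 2) := by
  rcases Nat.lt_or_ge t 2 with h | h
  · interval_cases t <;> norm_num
  · have : (2 : ℝ) ≤ t := by exact_mod_cast h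
    exact mul_nonneg (by linarith) (by linarith)

lemma binE_gapPoly (m r : ℕ) {p : ℝ} (hp : p < 1) :
    (-1) ^ r * binE (m + r) p (fun j => gapPoly r j) =
      (1 - p) ^ (m + r) * (r.factorial * ((r + 2) * (r + 3))) *
        (1 + (-1) ^ r * gapSum m r (p / (1 - p))) := by
  have hp' : 1 - p ≠ 0 := by linarith
  have h1 : binE (m + r) p (fun j => gapPoly r j) =
      (1 - p) ^ (m + r) * ((-1) ^ r * (r.factorial * ((r + 2) * (r + 3)))) +
      (1 - p) ^ (m + r) * (r.factorial * ((r + 2) * (r + 3))) * gapSum m r (p / (1 - p)) := by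
    rw [binE, Finset.sum_range_succ', Nat.add_comm m r, Finset.sum_range_add,
      Finset.sum_eq_zero fun j hj => ?_, zero_add, add_comm]
    · congr 1
      · simp [gapPoly_zero]
      · rw [gapSum, Finset.mul_sum]
        refine Finset.sum_congr rfl fun t ht => ?_
        have ht : t < m := by simpa using ht
        obtain ⟨d, hd⟩ : ∃ d, m = t + 1 + d := ⟨m - (t + 1), by omega⟩
        rw [gapPoly_of_ge, show r + m - (r + t + 1) = d by omega, Nat.add_comm m r,
          show (1 - p) ^ (r + m) = (1 - p) ^ d * (1 - p) ^ (r + t + 1) by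
            rw [← pow_add]; congr 1; omega, div_pow]
        field_simp
    · rw [gapPoly_of_lt (by simpa using hj), mul_zero]
  rw [h1]
  have h2 : ((-1 : ℝ) ^ r) * (-1) ^ r = 1 := by rw [← mul_pow]; simp
  linear_combination (1 - p) ^ (m + r) * (r.factorial * ((r + 2) * (r + 3)) : ℝ) * h2

lemma gapSum_nonneg (m r : ℕ) {q : ℝ} (hq : 0 ≤ q) : 0 ≤ gapSum m r q := by
  refine Finset.sum_nonneg fun t _ => ?_
  have := mul_sub_nonneg_of_nat t
  positivity

lemma binE_gapPoly_even_nonneg (m : ℕ) {r : ℕ} (hr : Even r) {p : ℝ} (h0 : 0 ≤ p) (hp : p < 1) :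
    0 ≤ (-1) ^ r * binE (m + r) p (fun j => gapPoly r j) := by
  have h1 : 0 < 1 - p := by linarith
  rw [binE_gapPoly m r hp, hr.neg_one_pow]
  have := gapSum_nonneg m r (div_nonneg h0 h1.le)
  positivity

lemma binE_gapPoly_odd_nonneg_iff (m : ℕ) {r : ℕ} (hr : Odd r) {p : ℝ} (hp : p < 1) :
    0 ≤ (-1) ^ r * binE (m + r) p (fun j => gapPoly r j) ↔ gapSum m r (p / (1 - p)) ≤ 1 := by
  have h1 : 0 < 1 - p := by linarith
  rw [binE_gapPoly m r hp, hr.neg_one_pow, mul_nonneg_iff_of_pos_left (by positivity)]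
  constructor <;> intro h <;> linarith

/-- The cubic of the statement, for `m = n - k + 2`. -/
def gapCubic (m : ℕ) (x : ℝ) : ℝ :=
  1 - (m + 1) * x + 5 / 12 * ((m + 1) * m) * x ^ 2 - 1 / 12 * ((m + 1) * m * (m - 1)) * x ^ 3

lemma binE_gapPoly_one (m : ℕ) (p : ℝ) :
    (-1) ^ 1 * binE (m + 1) p (fun j => gapPoly 1 j) = 12 * gapCubic m p := by
  have e : (fun j : ℕ => gapPoly 1 j) = fun j : ℕ =>
      (j.descFactorial 3 : ℝ) + (-5 * (j.descFactorial 2 : ℝ) +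
        (12 * (j.descFactorial 1 : ℝ) + -12 * 1)) := by
    funext j
    simp only [gapPoly, ← prod_range_sub_eq_descFactorial, Finset.prod_range_succ,
      Finset.prod_range_zero]
    push_cast
    ring
  rw [e, binE_add, binE_add, binE_add, binE_const_mul, binE_const_mul, binE_const_mul, binE_one,
    binE_descFactorial, binE_descFactorial, binE_descFactorial, gapCubic]
  simp only [← prod_range_sub_eq_descFactorial, Finset.prod_range_succ, Finset.prod_range_zero]
  push_cast
  ring

lemma cubic_eq_gapCubic {n k m : ℕ} (h : n - k + 3 = m + 1) : cubic n k = gapCubic m := by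
  funext x
  have h1 := Nat.descFactorial_eq_factorial_mul_choose (m + 1) 1
  have h2 := Nat.descFactorial_eq_factorial_mul_choose (m + 1) 2
  have h3 := Nat.descFactorial_eq_factorial_mul_choose (m + 1) 3
  rw [← Nat.cast_inj (R := ℝ), ← prod_range_sub_eq_descFactorial] at h1 h2 h3
  simp only [Finset.prod_range_succ, Finset.prod_range_zero, Nat.factorial] at h1 h2 h3
  push_cast at h1 h2 h3
  rw [cubic, h, gapCubic]
  linear_combination x * h1 - 5 / 12 * x ^ 2 * h2 + 1 / 12 * x ^ 3 * h3

lemma gapCubic_strictAnti {m : ℕ} (hm : 4 ≤ m) : StrictAnti (gapCubic m) := by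
  have hm' : (4 : ℝ) ≤ m := by exact_mod_cast hm
  intro x y hxy
  have h : gapCubic m x - gapCubic m y = (m + 1) * (y - x) *
      (1 - 5 / 12 * m * (x + y) + 1 / 12 * (m * (m - 1)) * (x ^ 2 + x * y + y ^ 2)) := by
    simp only [gapCubic]; ring
  have hpos : 0 < 1 - 5 / 12 * m * (x + y) +
      1 / 12 * (m * (m - 1)) * (x ^ 2 + x * y + y ^ 2) := by
    have h1 : 3 / 4 * (x + y) ^ 2 ≤ x ^ 2 + x * y + y ^ 2 := by nlinarith [sq_nonneg (x - y)]
    have h2 : 0 ≤ 1 / 12 * ((m : ℝ) * (m - 1)) := by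
      have : 0 ≤ (m : ℝ) - 1 := by linarith
      positivity
    have h3 := mul_le_mul_of_nonneg_left h1 h2
    have h4 : 3 / 64 * (m : ℝ) ^ 2 * (x + y) ^ 2 ≤
        1 / 12 * ((m : ℝ) * (m - 1)) * (3 / 4 * (x + y) ^ 2) := by
      have : 0 ≤ (m : ℝ) * (m - 4) * (x + y) ^ 2 :=
        mul_nonneg (mul_nonneg (by linarith) (by linarith)) (sq_nonneg _)
      linarith
    nlinarith [sq_nonneg ((m : ℝ) * (x + y) - 40 / 9)]
  have : 0 < gapCubic m x - gapCubic m y := by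
    rw [h]
    exact mul_pos (mul_pos (by linarith) (by linarith)) hpos
  linarith

lemma gapSum_add_two_le {m r : ℕ} {q : ℝ} (hm : 1 ≤ m) (hq : 0 ≤ q)
    (h : ((m : ℝ) + r) * (m + r + 1) * (r + 3) * q ^ 2 ≤ (r + 1) * (r + 4) * (r + 5)) :
    gapSum m (r + 2) q ≤ gapSum m r q := by
  refine Finset.sum_le_sum fun t ht => ?_
  have htm : t + 1 ≤ m := by simpa using ht
  have hstep : ∀ r : ℕ, ((m + (r + 1)).choose (r + 1 + t + 1) : ℝ) *
      ((r + 1 + t).choose (r + 1) : ℝ) * ((r + 1) * (r + t + 2)) =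
      ((m + r).choose (r + t + 1) : ℝ) * ((r + t).choose r : ℝ) * ((m + r + 1) * (r + t + 1)) := by
    intro r
    have h1 : ((m + r : ℕ) + 1 : ℝ) * ((m + r).choose (r + t + 1) : ℝ) =
        ((m + r + 1).choose (r + t + 1 + 1) : ℝ) * ((r + t + 1 : ℕ) + 1) := by
      exact_mod_cast Nat.add_one_mul_choose_eq (m + r) (r + t + 1)
    have h2 : ((r + t : ℕ) + 1 : ℝ) * ((r + t).choose r : ℝ) =
        ((r + t + 1).choose (r + 1) : ℝ) * ((r : ℕ) + 1) := by
      exact_mod_cast Nat.add_one_mul_choose_eq (r + t) r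
    rw [show r + 1 + t = r + t + 1 by omega, show m + (r + 1) = m + r + 1 by omega]
    push_cast at h1 h2
    linear_combination (-((r + t).choose r : ℝ) * (r + t + 1)) * h1 -
      ((m + r + 1).choose (r + t + 1 + 1) : ℝ) * (r + t + 2) * h2
  have e1 := hstep r
  have e2 := hstep (r + 1)
  set a := ((m + r).choose (r + t + 1) : ℝ) * ((r + t).choose r : ℝ) with ha
  set b := ((m + (r + 1)).choose (r + 1 + t + 1) : ℝ) * ((r + 1 + t).choose (r + 1) : ℝ)
  rw [show r + 2 = r + 1 + 1 from rfl]
  set c := ((m + (r + 1 + 1)).choose (r + 1 + 1 + t + 1) : ℝ) *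
    ((r + 1 + 1 + t).choose (r + 1 + 1) : ℝ)
  push_cast at e2 ⊢
  have ha0 : 0 ≤ a := by positivity
  have hc : c * ((r + 1) * (r + 2) * (r + t + 3)) =
      a * ((m + r + 1) * (m + r + 2) * (r + t + 1)) := by
    have h3 : (r : ℝ) + t + 2 ≠ 0 := by positivity
    refine mul_left_cancel₀ h3 ?_
    linear_combination (r + 1) * (r + t + 2) * e2 + (m + r + 2) * (r + t + 2) * e1
  have hkey : c * q ^ 2 * ((r + 2) * (r + 3)) ≤ a * ((r + 4) * (r + 5)) := by
    have h3 : (0 : ℝ) < (r + 1) * (r + t + 3) := by positivity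
    refine le_of_mul_le_mul_right ?_ h3
    have e3 : c * q ^ 2 * ((r + 2) * (r + 3)) * ((r + 1) * (r + t + 3)) =
        a * ((m + r + 1) * (r + 3) * q ^ 2 * ((m + r + 2) * (r + t + 1))) := by
      linear_combination q ^ 2 * (r + 3) * hc
    have htm' : (t : ℝ) + 1 ≤ m := by exact_mod_cast htm
    have h4 : ((m : ℝ) + r + 2) * (r + t + 1) ≤ (m + r) * (r + t + 3) := by nlinarith
    rw [e3, mul_assoc a ((r + 4 : ℝ) * (r + 5))]
    refine mul_le_mul_of_nonneg_left ?_ ha0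
    calc ((m : ℝ) + r + 1) * (r + 3) * q ^ 2 * ((m + r + 2) * (r + t + 1))
        ≤ ((m : ℝ) + r + 1) * (r + 3) * q ^ 2 * ((m + r) * (r + t + 3)) :=
          mul_le_mul_of_nonneg_left h4 (by positivity)
      _ = ((m : ℝ) + r) * (m + r + 1) * (r + 3) * q ^ 2 * (r + t + 3) := by ring
      _ ≤ ((r + 1) * (r + 4) * (r + 5)) * (r + t + 3) :=
          mul_le_mul_of_nonneg_right h (by positivity)
      _ = _ := by ring
  have ht0 := mul_sub_nonneg_of_nat t
  have hpow : q ^ (r + 1 + 1 + t + 1) = q ^ 2 * q ^ (r + t + 1) := by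
    rw [← pow_add]; congr 1; omega
  rw [hpow, ← mul_assoc]
  refine mul_le_mul_of_nonneg_right ?_ (by positivity)
  rw [div_mul_eq_mul_div, div_le_div_iff₀ (by positivity) (by positivity)]
  have := mul_le_mul_of_nonneg_right hkey ht0
  linarith

lemma gapSum_odd_le_one {m : ℕ} (hm : 4 ≤ m) {p : ℝ} (h0 : 0 ≤ p) (hp : (m - 1) * p ≤ 2)
    (hc : 0 ≤ gapCubic m p) (s : ℕ) : gapSum m (2 * s + 1) (p / (1 - p)) ≤ 1 := by
  have hm' : (4 : ℝ) ≤ m := by exact_mod_cast hm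
  have hp1 : p < 1 := by nlinarith
  have hp' : 0 < 1 - p := by linarith
  set q := p / (1 - p) with hqdef
  have hq0 : 0 ≤ q := div_nonneg h0 hp'.le
  have hqp : q * (1 - p) = p := div_mul_cancel₀ _ hp'.ne'
  have hone : gapSum m 1 q ≤ 1 := by
    rw [← binE_gapPoly_odd_nonneg_iff m odd_one hp1, binE_gapPoly_one]
    linarith
  rcases hm.eq_or_lt with rfl | hm5
  · have hp37 : p ≤ 3 / 7 := by
      by_contra! h
      have := gapCubic_strictAnti hm h
      norm_num [gapCubic] at this hc
      linarith
    have hq : q ≤ 3 / 4 := by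
      rw [hqdef, div_le_iff₀ hp']; linarith
    have h3 : gapSum 4 3 q ≤ 1 := by
      have e : gapSum 4 3 q = 7 / 3 * q ^ 4 + 4 / 3 * q ^ 7 := by
        norm_num [gapSum, Finset.sum_range_succ, Nat.choose]
      have h4 := pow_le_pow_left₀ hq0 hq 4
      have h7 := pow_le_pow_left₀ hq0 hq 7
      rw [e]
      norm_num at h4 h7
      linarith
    have hs : ∀ s : ℕ, gapSum 4 (2 * s + 3) q ≤ 1 := by
      intro s
      induction s with
      | zero => exact h3
      | succ s ih =>
        refine le_trans (gapSum_add_two_le (r := 2 * s + 3) (by norm_num) hq0 ?_) ih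
        have hq2 : q ^ 2 ≤ 9 / 16 := by nlinarith
        push_cast
        have : (4 + (2 * (s : ℝ) + 3)) * (4 + (2 * s + 3) + 1) * (2 * s + 3 + 3) * q ^ 2 ≤
          (4 + (2 * (s : ℝ) + 3)) * (4 + (2 * s + 3) + 1) * (2 * s + 3 + 3) * (9 / 16) :=
          mul_le_mul_of_nonneg_left hq2 (by positivity)
        refine this.trans ?_
        have hs0 : (0 : ℝ) ≤ s := Nat.cast_nonneg s
        have : 0 ≤ (2 * (s : ℝ) + 7) * (2 * s + 8) * s := by positivity
        nlinarith
    rcases s with _ | s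
    · exact hone
    · exact hs s
  · have hq2 : ((m : ℝ) + 1) * (m + 2) * q ^ 2 ≤ 15 := by
      have hpq : ((m : ℝ) + 1) * (m + 2) * p ^ 2 ≤ 15 * (1 - p) ^ 2 := by
        rcases Nat.lt_or_ge m 8 with h8 | h8
        · have hle : ∀ b : ℝ, gapCubic m b < 0 → p ≤ b := by
            intro b hb
            by_contra! h
            have := gapCubic_strictAnti hm h
            linarith
          interval_cases m
          · have := hle (373 / 1000) (by norm_num [gapCubic])
            norm_num; nlinarith
          · have := hle (341 / 1000) (by norm_num [gapCubic])
            norm_num; nlinarith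
          · have := hle (313 / 1000) (by norm_num [gapCubic])
            norm_num; nlinarith
        · have h8' : (8 : ℝ) ≤ m := by exact_mod_cast h8
          have h1 : (m - 3) * p ≤ 2 * (1 - p) := by linarith
          have h2 : ((m - 3) * p) ^ 2 ≤ (2 * (1 - p)) ^ 2 :=
            pow_le_pow_left₀ (mul_nonneg (by linarith) h0) h1 2
          have h3 : 4 * (((m : ℝ) + 1) * (m + 2)) ≤ 15 * (m - 3) ^ 2 := by nlinarith
          nlinarith [mul_le_mul_of_nonneg_right h3 (sq_nonneg p)]
      have h2 : 0 < (1 - p) ^ 2 := by positivity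
      rw [hqdef, div_pow, mul_div_assoc', div_le_iff₀ h2]
      exact hpq
    have hm5' : (5 : ℝ) ≤ m := by exact_mod_cast hm5
    induction s with
    | zero => exact hone
    | succ s ih =>
      refine le_trans (gapSum_add_two_le (r := 2 * s + 1) (by omega) hq0 ?_) ih
      have hpos : 0 < ((m : ℝ) + 1) * (m + 2) := by positivity
      refine le_of_mul_le_mul_right ?_ hpos
      push_cast
      obtain ⟨a, ha, hma⟩ : ∃ a : ℝ, 0 ≤ a ∧ (m : ℝ) = 5 + a := ⟨m - 5, by linarith, by ring⟩
      have hs0 : (0 : ℝ) ≤ s := Nat.cast_nonneg s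
      calc ((m : ℝ) + (2 * s + 1)) * (m + (2 * s + 1) + 1) * (2 * s + 1 + 3) * q ^ 2 *
            ((m + 1) * (m + 2))
          = ((m : ℝ) + (2 * s + 1)) * (m + (2 * s + 1) + 1) * (2 * s + 1 + 3) *
            ((m + 1) * (m + 2) * q ^ 2) := by ring
        _ ≤ ((m : ℝ) + (2 * s + 1)) * (m + (2 * s + 1) + 1) * (2 * s + 1 + 3) * 15 :=
            mul_le_mul_of_nonneg_left hq2 (by positivity)
        _ ≤ _ := by
            rw [hma, ← sub_nonneg]
            ring_nf
            positivity

lemma nodeWeight_last_eq_bonf {n k K m : ℕ} (hm : 4 ≤ m) (hk : k = K + 2) (hn : n = K + m)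
    (p : ℝ) :
    1 / ((n - k + 1).choose 2 : ℝ) * p ^ (k - 2) * bonf (n - k + 2) 2 p =
      nodeWeight (nodes K m) (K + m) p (K + m) := by
  subst hk hn
  have hm' : (4 : ℝ) ≤ m := by exact_mod_cast hm
  have hb : bonf m 2 p = 1 - m * p + m * (m - 1) / 2 * p ^ 2 := by
    have : Int.toNat 2 = 2 := rfl
    simp only [bonf, this, Finset.sum_range_succ, Finset.sum_range_zero, Nat.cast_choose_two]
    norm_num
    ring
  rw [nodeWeight_last hm, show K + m - (K + 2) + 1 = m - 1 by omega,
    show K + m - (K + 2) + 2 = m by omega, Nat.add_sub_cancel, hb, Nat.cast_choose_two,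
    Nat.cast_sub (by omega), Nat.cast_one, sub_sub (m : ℝ) 1 1, one_add_one_eq_two]
  have h1 : (m : ℝ) - 1 ≠ 0 := by linarith
  have h2 : (m : ℝ) - 2 ≠ 0 := by linarith
  field_simp

lemma nodeWeight_last_pos {K m : ℕ} (hm : 4 ≤ m) {p : ℝ} (hp : 0 < p) :
    0 < nodeWeight (nodes K m) (K + m) p (K + m) := by
  rw [nodeWeight_last hm]
  have hm' : (4 : ℝ) ≤ m := by exact_mod_cast hm
  have h1 : 0 < 2 - 2 * (m * p) + (m : ℝ) * (m - 1) * p ^ 2 := by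
    nlinarith [sq_nonneg (m * p - 4 / 3), mul_nonneg (show (0 : ℝ) ≤ m by linarith)
      (mul_nonneg (show (0 : ℝ) ≤ m - 4 by linarith) (sq_nonneg p))]
  have h2 : 0 < (m : ℝ) - 1 := by linarith
  have h3 : 0 < (m : ℝ) - 2 := by linarith
  positivity

lemma M_eq_of_gapCubic_nonneg {K m : ℕ} (hm : 4 ≤ m) {p : ℝ} (h1 : 1 ≤ ((m : ℝ) - 1) * p)
    (h2 : ((m : ℝ) - 1) * p ≤ 2) (hc : 2 ≤ K → 0 ≤ gapCubic m p) :
    M (K + m) (K + 2) p = nodeWeight (nodes K m) (K + m) p (K + m) := by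
  have hm' : (4 : ℝ) ≤ m := by exact_mod_cast hm
  have hp0 : 0 < p := by
    by_contra! h
    nlinarith
  have hp1 : p < 1 := by nlinarith
  have hp1' : 0 ≤ 1 - p := by linarith
  refine M_eq_nodeWeight (card_nodes K m hm) (le_of_mem_nodes hm) (last_mem_nodes K m)
    (fun j hj hjV => eval_nodeBasis_last_pos hm j hj hjV) (by omega) fun v hv => ?_
  rcases mem_nodes.1 hv with rfl | rfl | rfl | h
  · obtain ⟨c, hc, e⟩ := nodeWeight_one (K := K) hm p
    have : 0 ≤ 2 - ((m : ℝ) - 1) * p := by linarith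
    rw [e]
    positivity
  · obtain ⟨c, hc, e⟩ := nodeWeight_two (K := K) hm p
    have : 0 ≤ ((m : ℝ) - 1) * p - 1 := by linarith
    rw [e]
    positivity
  · exact (nodeWeight_last_pos hm hp0).le
  · obtain ⟨r, rfl⟩ : ∃ r, K = v + 1 + r := ⟨K - (v + 1), by omega⟩
    obtain ⟨c, hc', e⟩ := nodeWeight_low (i := v) (r := r) hm p
    have : 0 ≤ (-1) ^ r * binE (m + r) p fun j => gapPoly r j := by
      rcases Nat.even_or_odd r with hr | hr
      · exact binE_gapPoly_even_nonneg m hr hp0.le hp1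
      · rw [binE_gapPoly_odd_nonneg_iff m hr hp1]
        obtain ⟨s, rfl⟩ := hr
        exact gapSum_odd_le_one hm hp0.le h2 (hc (by omega)) s
    rw [e]
    positivity

lemma M_lt_of_two_lt {K m : ℕ} (hm : 4 ≤ m) {p : ℝ} (hp0 : 0 < p) (hp1 : p < 1)
    (h2 : 2 < ((m : ℝ) - 1) * p) :
    M (K + m) (K + 2) p < nodeWeight (nodes K m) (K + m) p (K + m) := by
  obtain ⟨c, hc, e⟩ := nodeWeight_one (K := K) hm p
  refine M_lt_nodeWeight (card_nodes K m hm) (last_mem_nodes K m)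
    (fun j hj hjV => eval_nodeBasis_last_pos hm j hj hjV) (i := K + 1) (by simp [mem_nodes])
    (by omega) ?_ (nodeWeight_last_pos hm hp0)
  rw [e]
  have h3 : 0 < 1 - p := by linarith
  exact mul_neg_of_pos_of_neg hc (mul_neg_of_pos_of_neg (by positivity)
    (mul_neg_of_pos_of_neg h3 (by linarith)))

lemma M_lt_of_gapCubic_neg {K m : ℕ} (hm : 4 ≤ m) (hK : 2 ≤ K) {p : ℝ} (hp0 : 0 < p)
    (hp1 : p < 1) (hc : gapCubic m p < 0) :
    M (K + m) (K + 2) p < nodeWeight (nodes K m) (K + m) p (K + m) := by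
  obtain ⟨i, rfl⟩ : ∃ i, K = i + 1 + 1 := ⟨K - 2, by omega⟩
  obtain ⟨c, hc', e⟩ := nodeWeight_low (i := i) (r := 1) hm p
  refine M_lt_nodeWeight (card_nodes _ m hm) (last_mem_nodes _ m)
    (fun j hj hjV => eval_nodeBasis_last_pos hm j hj hjV) (i := i)
    (mem_nodes.2 (by omega)) (by omega) ?_ (nodeWeight_last_pos hm hp0)
  rw [e, binE_gapPoly_one]
  have h3 : 0 < 1 - p := by linarith
  exact mul_neg_of_pos_of_neg hc' (mul_neg_of_pos_of_neg (by positivity)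
    (mul_neg_of_pos_of_neg h3 (by linarith)))

lemma csSup_initial_segment_eq {Q : ℝ → Prop} {a b c : ℝ} (hab : a ≤ b) (hbc : b < c)
    (hQ : ∀ p, a ≤ p → p ≤ b → Q p) (hnQ : ∀ p, b < p → p < c → ¬ Q p) :
    sSup {x : ℝ | a ≤ x ∧ ∀ p ∈ Set.Icc a x, Q p} = b := by
  refine IsGreatest.csSup_eq ⟨⟨hab, fun p hp => hQ p hp.1 hp.2⟩, fun x hx => ?_⟩
  by_contra! h
  obtain ⟨p, hp, hp'⟩ := exists_between (lt_min h hbc)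
  exact hnQ p hp (hp'.trans_le (min_le_right _ _))
    (hx.2 p ⟨hab.trans hp.le, hp'.le.trans (min_le_left _ _)⟩)

lemma exists_gapCubic_eq_zero {m : ℕ} (hm : 4 ≤ m) :
    ∃ z ∈ Set.Icc (1 / ((m : ℝ) - 1)) (2 / ((m : ℝ) - 1)), gapCubic m z = 0 := by
  have hm' : (4 : ℝ) ≤ m := by exact_mod_cast hm
  have h1 : 0 < (m : ℝ) - 1 := by linarith
  have hle : 1 / ((m : ℝ) - 1) ≤ 2 / ((m : ℝ) - 1) := by gcongr; norm_num
  have hcont : ContinuousOn (gapCubic m) (Set.Icc (1 / ((m : ℝ) - 1)) (2 / ((m : ℝ) - 1))) := by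
    unfold gapCubic
    fun_prop
  have ha : gapCubic m (1 / ((m : ℝ) - 1)) = (m - 2) * (m - 3) / (3 * (m - 1) ^ 2) := by
    rw [gapCubic]
    field_simp
    ring
  have hb : gapCubic m (2 / ((m : ℝ) - 1)) = (3 - m) / (m - 1) ^ 2 := by
    rw [gapCubic]
    field_simp
    ring
  refine intermediate_value_Icc' hle hcont ⟨?_, ?_⟩
  · rw [hb]
    exact div_nonpos_of_nonpos_of_nonneg (by linarith) (by positivity)
  · rw [ha]
    have h2 : 0 < (m : ℝ) - 2 := by linarith
    have h3 : 0 < (m : ℝ) - 3 := by linarith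
    positivity

/-- identification of the right endpoint `ρ` of the second interval. -/
theorem stmt12 (n k : ℕ) (hk : 2 ≤ k) (hkn : k + 2 ≤ n) (ρ : ℝ)
    (hρ : ρ = sSup {p₂ : ℝ | 1 / ((n:ℝ) - (k:ℝ) + 1) ≤ p₂ ∧
      ∀ p ∈ Set.Icc (1 / ((n:ℝ) - (k:ℝ) + 1)) p₂,
        M n k p = (1 / ((n - k + 1).choose 2 : ℝ)) * p ^ (k - 2) * bonf (n - k + 2) 2 p}) :
    (k = 2 → ρ = 2 / ((n:ℝ) - 1)) ∧
    (k = 3 → ρ = 2 / ((n:ℝ) - 2)) ∧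
    (4 ≤ k → ∃ z : ℝ,
      z ∈ Set.Icc (1 / ((n:ℝ) - (k:ℝ) + 1)) (2 / ((n:ℝ) - (k:ℝ) + 1)) ∧
      cubic n k z = 0 ∧
      (∀ y ∈ Set.Icc (1 / ((n:ℝ) - (k:ℝ) + 1)) (2 / ((n:ℝ) - (k:ℝ) + 1)),
        cubic n k y = 0 → y = z) ∧
      ρ = z) := by
  obtain ⟨K, rfl⟩ : ∃ K, k = K + 2 := ⟨k - 2, by omega⟩
  obtain ⟨m, rfl⟩ : ∃ m, n = K + m := ⟨n - K, by omega⟩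
  have hm : 4 ≤ m := by omega
  have hm' : (4 : ℝ) ≤ m := by exact_mod_cast hm
  have hm1 : 0 < (m : ℝ) - 1 := by linarith
  have hcast : ((K + m : ℕ) : ℝ) - ((K + 2 : ℕ) : ℝ) + 1 = m - 1 := by push_cast; ring
  have hlt : 2 / ((m : ℝ) - 1) < 1 := by rw [div_lt_one hm1]; linarith
  have hle : 1 / ((m : ℝ) - 1) ≤ 2 / ((m : ℝ) - 1) := by gcongr; norm_num
  have hpos : 0 < 1 / ((m : ℝ) - 1) := by positivity
  simp only [nodeWeight_last_eq_bonf hm rfl rfl, hcast] at hρ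
  rw [hcast, cubic_eq_gapCubic (show K + m - (K + 2) + 3 = m + 1 by omega)]
  have hsmall : K < 2 → ρ = 2 / ((m : ℝ) - 1) := by
    intro hK
    rw [hρ]
    refine csSup_initial_segment_eq hle hlt (fun p hp1 hp2 => ?_) (fun p hp1 hp2 => ?_)
    · rw [div_le_iff₀' hm1] at hp1
      rw [le_div_iff₀' hm1] at hp2
      exact M_eq_of_gapCubic_nonneg hm hp1 hp2 fun h => by omega
    · have hp0 : 0 < p := by linarith
      rw [div_lt_iff₀' hm1] at hp1
      exact (M_lt_of_two_lt hm hp0 hp2 hp1).ne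
  refine ⟨fun hK => ?_, fun hK => ?_, fun hK => ?_⟩
  · obtain rfl : K = 0 := by omega
    rw [hsmall (by omega)]
    simp
  · obtain rfl : K = 1 := by omega
    rw [hsmall (by omega)]
    congr 1
    push_cast
    ring
  · obtain ⟨z, hz, hz0⟩ := exists_gapCubic_eq_zero hm
    have hanti := gapCubic_strictAnti hm
    refine ⟨z, hz, hz0, fun y _ hy => hanti.injective (hy.trans hz0.symm), ?_⟩
    rw [hρ]
    refine csSup_initial_segment_eq hz.1 (hz.2.trans_lt hlt) (fun p hp1 hp2 => ?_) (fun p hp1 hp2 => ?_)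
    · have hp3 := hp2.trans hz.2
      rw [div_le_iff₀' hm1] at hp1
      rw [le_div_iff₀' hm1] at hp3
      exact M_eq_of_gapCubic_nonneg hm hp1 hp3 fun _ => hz0 ▸ hanti.antitone hp2
    · have hp0 : 0 < p := by linarith [hz.1]
      exact (M_lt_of_gapCubic_neg hm (by omega) hp0 hp2 (hz0 ▸ hanti hp1)).ne
end
end

section
/- Let 0 ≤ k ≤ n be integers. Then for every real p, B(n,k,p) = (1−p)^k − Σ_{i=0}^{k−1} C(n−k, k−i) · p^{k−i} · B(n−k+i, i, p). -/
open scoped BigOperators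

noncomputable section

lemma bonf_natCast (m l : ℕ) (x : ℝ) :
    bonf m l x = ∑ i ∈ Finset.range (l + 1), (-1 : ℝ) ^ i * (m.choose i) * x ^ i := by
  simp [bonf]

lemma bonf_self (m : ℕ) (x : ℝ) : bonf m m x = (1 - x) ^ m := by
  rw [bonf_natCast, sub_eq_neg_add, add_pow]
  refine Finset.sum_congr rfl fun i _ => ?_
  rw [neg_pow x, one_pow]
  ring

lemma bonf_succ_succ (m l : ℕ) (x : ℝ) :
    bonf (m + 1) (l + 1 : ℕ) x = bonf m (l + 1 : ℕ) x - x * bonf m l x := by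
  simp only [bonf_natCast]
  rw [Finset.sum_range_succ', Finset.sum_range_succ' _ (l + 1), Finset.mul_sum,
    add_sub_right_comm, ← Finset.sum_sub_distrib]
  congr 1
  · refine Finset.sum_congr rfl fun i _ => ?_
    rw [Nat.choose_succ_succ]
    push_cast
    ring
  · simp

open PowerSeries in
lemma mk_choose_mul_pow_succ (m : ℕ) (x : ℝ) :
    PowerSeries.mk (fun a => ((m + 1).choose a : ℝ) * x ^ a) =
      PowerSeries.mk (fun a => (m.choose a : ℝ) * x ^ a) * (1 + C x * X) := by
  ext a
  rw [mul_add, mul_one, ← mul_assoc, map_add]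
  cases a with
  | zero => simp
  | succ a =>
    simp only [coeff_succ_mul_X, coeff_mul_C, coeff_mk, Nat.choose_succ_succ]
    push_cast
    ring

open PowerSeries in
lemma mk_bonf_succ_mul (m : ℕ) (x : ℝ) :
    PowerSeries.mk (fun i : ℕ => bonf (m + 1 + i) i x) * (1 + C x * X) =
      PowerSeries.mk (fun i : ℕ => bonf (m + i) i x) := by
  ext i
  rw [mul_add, mul_one, ← mul_assoc, map_add]
  cases i with
  | zero => simp [bonf]
  | succ i =>
    simp only [coeff_succ_mul_X, coeff_mul_C, coeff_mk]
    rw [show m + 1 + (i + 1) = m + (i + 1) + 1 by ring, bonf_succ_succ,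
      show m + 1 + i = m + (i + 1) by ring]
    ring

lemma mk_choose_mul_mk_bonf (m : ℕ) (x : ℝ) :
    PowerSeries.mk (fun a => (m.choose a : ℝ) * x ^ a) *
      PowerSeries.mk (fun i : ℕ => bonf (m + i) i x) =
      PowerSeries.mk (fun i => (1 - x) ^ i) := by
  induction m with
  | zero =>
    have h : PowerSeries.mk (fun a => ((0 : ℕ).choose a : ℝ) * x ^ a) = 1 := by
      ext a
      cases a <;> simp [PowerSeries.coeff_one]
    simp [h, bonf_self]
  | succ m ih =>
    rw [mk_choose_mul_pow_succ, mul_assoc, mul_comm (1 + _), mk_bonf_succ_mul, ih]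

lemma sum_choose_mul_pow_mul_bonf (m k : ℕ) (x : ℝ) :
    ∑ i ∈ Finset.range (k + 1), (m.choose (k - i) : ℝ) * x ^ (k - i) * bonf (m + i) i x =
      (1 - x) ^ k := by
  have h := congrArg (PowerSeries.coeff k) (mk_choose_mul_mk_bonf m x)
  rw [mul_comm, PowerSeries.coeff_mul, Finset.Nat.sum_antidiagonal_eq_sum_range_succ_mk] at h
  simp only [PowerSeries.coeff_mk] at h
  rw [← h]
  exact Finset.sum_congr rfl fun i _ => mul_comm _ _

/-- `B(n,k,p) = (1-p)^k - Σ_{i=0}^{k-1} C(n-k, k-i) p^{k-i} B(n-k+i, i, p)`. -/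
theorem stmt17 (n k : ℕ) (hkn : k ≤ n) (p : ℝ) :
    bonf n (k : ℤ) p = (1 - p) ^ k -
      ∑ i ∈ Finset.range k,
        ((n - k).choose (k - i) : ℝ) * p ^ (k - i) * bonf (n - k + i) (i : ℤ) p := by
  have h := sum_choose_mul_pow_mul_bonf (n - k) k p
  rw [Finset.sum_range_succ] at h
  simp only [Nat.sub_self, Nat.choose_zero_right, Nat.cast_one, pow_zero, one_mul,
    Nat.sub_add_cancel hkn] at h
  linarith
end
end
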